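/- arXiv:quant-ph/0308089 — 2 statements merged into one kernel-verified Lean document; each statement's English description precedes it below -/
import Mathlib

section
/- Let Φ : Matrix (Fin 2) (Fin 2) ℂ → Matrix (Fin 2) (Fin 2) ℂ be a linear map that is unital (Φ(1) = 1), trace-preserving (trace(Φ(ρ)) = trace(ρ) for all ρ), and Hermiticity-preserving (Φ(ρ)ᴴ = Φ(ρ) whenever ρᴴ = ρ). Then there exist unitary 2×2 complex matrices U_0, U_1, U_2, U_3 and real numbers β_0, β_1, β_2, β_3 with β_0 + β_1 + β_2 + β_3 = 1 such that Φ(ρ) = ∑_{i=0}^3 β_i • (U_i * ρ * U_iᴴ) for every 2×2 complex matrix ρ; i.e., every unital, trace- and Hermiticity-preserving superoperator on M_2 is a real linear combination of unitary conjugations with coefficients summing to 1. -/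
open scoped Matrix

/-- The unit quaternions `1`, `i σ₁`, `i σ₂`, `i σ₃` as complex matrices. -/
noncomputable def quaternionBasis : Fin 4 → Matrix (Fin 2) (Fin 2) ℂ :=
  ![1, !![0, Complex.I; Complex.I, 0], !![0, 1; -1, 0], !![Complex.I, 0; 0, -Complex.I]]

/-- The complex matrix of the quaternion with real coordinates `v`. -/
noncomputable def quaternionMatrix (v : Fin 4 → ℝ) : Matrix (Fin 2) (Fin 2) ℂ :=
  ∑ a, v a • quaternionBasis a

theorem quaternionMatrix_mul_conjTranspose (v : Fin 4 → ℝ) (hv : ∑ a, v a * v a = 1) :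
    quaternionMatrix v * (quaternionMatrix v)ᴴ = 1 := by
  simp only [Fin.sum_univ_four] at hv
  ext k l
  fin_cases k <;> fin_cases l <;>
    simp [quaternionMatrix, quaternionBasis, Fin.sum_univ_four, Matrix.mul_apply,
      Complex.ext_iff] <;>
    (try constructor) <;> linarith

theorem quaternionMatrix_conj (v : Fin 4 → ℝ) (ρ : Matrix (Fin 2) (Fin 2) ℂ) :
    quaternionMatrix v * ρ * (quaternionMatrix v)ᴴ =
      ∑ a, ∑ b, (v a * v b) • (quaternionBasis a * ρ * (quaternionBasis b)ᴴ) := by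
  simp only [quaternionMatrix, Matrix.conjTranspose_sum, Matrix.conjTranspose_smul,
    Finset.sum_mul, Finset.mul_sum, smul_mul_assoc, mul_smul_comm, star_trivial,
    Finset.smul_sum, smul_smul]
  rw [Finset.sum_comm]
  simp only [mul_comm]

/-- A real symmetric matrix is a combination of the rank-one projections onto an
orthonormal basis, with weights summing to its trace. -/
theorem Matrix.IsSymm.exists_sum_rank_one {n : Type*} [Fintype n] [DecidableEq n]
    {X : Matrix n n ℝ} (hX : X.IsSymm) :
    ∃ (v : n → n → ℝ) (β : n → ℝ), (∀ i, ∑ a, v i a * v i a = 1) ∧ ∑ i, β i = X.trace ∧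
      ∀ a b, X a b = ∑ i, β i * (v i a * v i b) := by
  have hH : X.IsHermitian := by
    rw [Matrix.IsHermitian, Matrix.conjTranspose_eq_transpose_of_trivial]; exact hX
  refine ⟨fun i a => hH.eigenvectorUnitary.1 a i, hH.eigenvalues, fun i => ?_, ?_, fun a b => ?_⟩
  · have h := congrFun (congrFun (Unitary.coe_star_mul_self hH.eigenvectorUnitary) i) i
    simpa [Matrix.mul_apply, Matrix.star_apply] using h
  · simpa using hH.trace_eq_sum_eigenvalues.symm
  · have h := congrFun (congrFun hH.spectral_theorem a) b
    rw [h, Unitary.conjStarAlgAut_apply, Matrix.mul_apply]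
    refine Finset.sum_congr rfl fun i _ => ?_
    simp [Matrix.mul_diagonal, Matrix.star_apply]
    ring

/-- In the quaternion basis, the process matrix of a unital, trace- and Hermiticity-preserving
map is real symmetric of trace one. -/
theorem exists_real_process_matrix
    (Φ : Matrix (Fin 2) (Fin 2) ℂ →ₗ[ℂ] Matrix (Fin 2) (Fin 2) ℂ)
    (hunital : Φ 1 = 1)
    (htrace : ∀ ρ : Matrix (Fin 2) (Fin 2) ℂ, (Φ ρ).trace = ρ.trace)
    (hherm : ∀ ρ : Matrix (Fin 2) (Fin 2) ℂ, ρᴴ = ρ → (Φ ρ)ᴴ = Φ ρ) :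
    ∃ X : Matrix (Fin 4) (Fin 4) ℝ, X.IsSymm ∧ X.trace = 1 ∧
      ∀ ρ, Φ ρ = ∑ a, ∑ b, X a b • (quaternionBasis a * ρ * (quaternionBasis b)ᴴ) := by
  set A := Φ !![1, 0; 0, 0] with hA
  set C := Φ !![0, 1; 0, 0] with hC
  set D := Φ !![0, 0; 1, 0] with hD
  have hB : Φ !![0, 0; 0, 1] = 1 - A := by
    rw [← hunital, hA, ← map_sub]
    congr 1
    ext k l
    fin_cases k <;> fin_cases l <;> simp
  have hAH : Aᴴ = A := hherm _ (by ext k l; fin_cases k <;> fin_cases l <;> simp)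
  have hCD : (C + D)ᴴ = C + D := by
    rw [hC, hD, ← map_add]
    exact hherm _ (by ext k l; fin_cases k <;> fin_cases l <;> simp)
  have hCD' : (Complex.I • C - Complex.I • D)ᴴ = Complex.I • C - Complex.I • D := by
    rw [hC, hD, ← Φ.map_smul, ← Φ.map_smul, ← Φ.map_sub]
    exact hherm _ (by ext k l; fin_cases k <;> fin_cases l <;> simp)
  have hDC : D = Cᴴ := by
    ext k l
    have h1 := congrFun (congrFun hCD k) l
    have h2 := congrFun (congrFun hCD' k) l
    simp [Complex.ext_iff] at h1 h2 ⊢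
    constructor <;> linarith
  have hAt : A.trace = 1 := by rw [hA, htrace]; simp [Matrix.trace]
  have hCt : C.trace = 0 := by rw [hC, htrace]; simp [Matrix.trace]
  have hρ : ∀ ρ, Φ ρ = ρ 0 0 • A + ρ 0 1 • C + ρ 1 0 • Cᴴ + ρ 1 1 • (1 - A) := by
    intro ρ
    rw [← hDC, ← hB, hA, hC, hD]
    simp only [← map_smul, ← map_add]
    congr 1
    ext k l
    fin_cases k <;> fin_cases l <;> simp
  clear_value A C
  have a00 := congrFun (congrFun hAH 0) 0
  have a01 := congrFun (congrFun hAH 0) 1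
  simp only [Matrix.trace_fin_two, Matrix.conjTranspose_apply] at hAt hCt a00 a01
  obtain ⟨a, ha⟩ : ∃ a : ℝ, A 0 0 = a := ⟨(A 0 0).re, (Complex.conj_eq_iff_re.1 a00).symm⟩
  let x01 := -((A 0 1).im + (C 0 0).im) / 2
  let x02 := ((C 0 0).re - (A 0 1).re) / 2
  let x03 := (C 0 1).im / 2
  let x12 := (C 1 0).im / 2
  let x13 := ((A 0 1).re + (C 0 0).re) / 2
  let x23 := ((C 0 0).im - (A 0 1).im) / 2
  refine ⟨!![(a + (C 0 1).re) / 2, x01, x02, x03;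
    x01, (1 - a + (C 1 0).re) / 2, x12, x13;
    x02, x12, (1 - a - (C 1 0).re) / 2, x23;
    x03, x13, x23, (a - (C 0 1).re) / 2], ?_, ?_, fun ρ => ?_⟩
  · ext k l
    fin_cases k <;> fin_cases l <;> rfl
  · simp [Matrix.trace, Fin.sum_univ_four]
    ring
  · obtain ⟨p, q, r, s, rfl⟩ : ∃ p q r s, ρ = !![p, q; r, s] :=
      ⟨_, _, _, _, Matrix.eta_fin_two ρ⟩
    rw [hρ]
    have hstar (p q r s : ℂ) : !![p, q; r, s]ᴴ = !![star p, star r; star q, star s] := by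
      ext k l
      fin_cases k <;> fin_cases l <;> rfl
    have hA11 : A 1 1 = 1 - a := by linear_combination hAt - ha
    have hC11 : C 1 1 = - C 0 0 := by linear_combination hCt
    ext k l
    fin_cases k <;> fin_cases l <;>
      simp [quaternionBasis, Fin.sum_univ_four, hstar, ha, hA11,
        hC11, ← a01, Complex.ext_iff, x01, x02, x03, x12, x13, x23] <;>
      constructor <;> ring

theorem stmt_12 (Φ : Matrix (Fin 2) (Fin 2) ℂ →ₗ[ℂ] Matrix (Fin 2) (Fin 2) ℂ)
    (hunital : Φ 1 = 1)
    (htrace : ∀ ρ : Matrix (Fin 2) (Fin 2) ℂ, (Φ ρ).trace = ρ.trace)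
    (hherm : ∀ ρ : Matrix (Fin 2) (Fin 2) ℂ, ρᴴ = ρ → (Φ ρ)ᴴ = Φ ρ) :
    ∃ (U : Fin 4 → Matrix (Fin 2) (Fin 2) ℂ) (β : Fin 4 → ℝ),
      (∀ i, U i * (U i)ᴴ = 1) ∧ (∑ i, β i) = 1 ∧
      ∀ ρ : Matrix (Fin 2) (Fin 2) ℂ, Φ ρ = ∑ i, β i • (U i * ρ * (U i)ᴴ) := by
  obtain ⟨X, hX, hXt, hΦ⟩ := exists_real_process_matrix Φ hunital htrace hherm
  obtain ⟨v, β, hv, hβ, hXv⟩ := hX.exists_sum_rank_one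
  refine ⟨fun i => quaternionMatrix (v i), β,
    fun i => quaternionMatrix_mul_conjTranspose _ (hv i), hβ.trans hXt, fun ρ => ?_⟩
  simp only [hΦ, hXv, quaternionMatrix_conj, Finset.sum_smul, Finset.smul_sum, smul_smul]
  rw [Finset.sum_comm_cycle]
end

section
/- Let A, B be real 3×3 matrices with AᵀA = 1, det A = 1, BᵀB = 1, det B = 1, let d₁, d₂, d₃ ∈ ℝ, and set M = B * Matrix.diagonal (d₁, d₂, d₃) * A. Let Φ_M be the unique linear map on 2×2 complex matrices with Φ_M(σ_0) = σ_0 and Φ_M(∑_i r_i • σ_i) = ∑_i (M r)_i • σ_i for all r ∈ ℝ³. Then Φ_M is completely positive if and only if 1 − d₃ ≥ |d₁ − d₂| and 1 + d₃ ≥ |d₁ + d₂|. -/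
open scoped ComplexOrder Matrix

/-- The Pauli matrices `σ_0, σ_1, σ_2, σ_3`. -/
def pauli : Fin 4 → Matrix (Fin 2) (Fin 2) ℂ :=
  ![!![1, 0; 0, 1], !![0, 1; 1, 0], !![0, -Complex.I; Complex.I, 0], !![1, 0; 0, -1]]

/-- `Φ` is completely positive: for every `m ≥ 1`, the map `id_m ⊗ Φ` (acting blockwise on
`m × m` block matrices with `N × N` blocks) maps positive semidefinite matrices to positive
semidefinite matrices. -/
def CompletelyPositive {N : ℕ}
    (Φ : Matrix (Fin N) (Fin N) ℂ → Matrix (Fin N) (Fin N) ℂ) : Prop :=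
  ∀ m : ℕ, 1 ≤ m → ∀ M : Matrix (Fin m × Fin N) (Fin m × Fin N) ℂ, M.PosSemidef →
    (Matrix.of fun p q : Fin m × Fin N =>
      Φ (Matrix.of fun a b : Fin N => M (p.1, a) (q.1, b)) p.2 q.2).PosSemidef

/-- The Choi matrix of a map on matrices. -/
def choiMatrix {N : ℕ} (Φ : Matrix (Fin N) (Fin N) ℂ → Matrix (Fin N) (Fin N) ℂ) :
    Matrix (Fin N × Fin N) (Fin N × Fin N) ℂ :=
  Matrix.of fun p q => Φ (Matrix.single p.1 q.1 1) p.2 q.2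

open scoped MatrixOrder Matrix.Norms.L2Operator in
theorem Matrix.PosSemidef.exists_eq_conjTranspose_mul_self {n : Type*} [Fintype n] [DecidableEq n]
    {C : Matrix n n ℂ} (hC : C.PosSemidef) : ∃ R : Matrix n n ℂ, C = Rᴴ * R :=
  CStarAlgebra.nonneg_iff_eq_star_mul_self.mp hC.nonneg

/-- **Choi's theorem**: a linear map is completely positive iff its Choi matrix is positive
semidefinite. -/
theorem completelyPositive_iff_posSemidef_choiMatrix {N : ℕ} (hN : 1 ≤ N)
    (Φ : Matrix (Fin N) (Fin N) ℂ →ₗ[ℂ] Matrix (Fin N) (Fin N) ℂ) :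
    CompletelyPositive Φ ↔ (choiMatrix Φ).PosSemidef := by
  constructor
  · intro h
    let v : Fin N × Fin N → ℂ := fun p => if p.1 = p.2 then 1 else 0
    have hv := h N hN (Matrix.vecMulVec v (star v)) (Matrix.posSemidef_vecMulVec_self_star v)
    convert hv using 1
    ext p q
    simp only [choiMatrix, Matrix.of_apply]
    refine congrFun (congrFun (congrArg Φ ?_) p.2) q.2
    ext a b
    simp only [Matrix.single, Matrix.of_apply, Matrix.vecMulVec_apply, Pi.star_apply, v]
    by_cases h1 : p.1 = a <;> by_cases h2 : q.1 = b <;> simp [h1, h2]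
  · intro h m _ X hX
    obtain ⟨R, hR⟩ : ∃ R : Matrix (Fin N × Fin N) (Fin N × Fin N) ℂ, choiMatrix Φ = Rᴴ * R :=
      h.exists_eq_conjTranspose_mul_self
    have hΦ (Y : Matrix (Fin N) (Fin N) ℂ) (a b : Fin N) :
        Φ Y a b = ∑ k, ∑ i, ∑ j, star (R k (i, a)) * Y i j * R k (j, b) := by
      have hC (i j : Fin N) :
          Φ (Matrix.single i j 1) a b = ∑ k, star (R k (i, a)) * R k (j, b) := by
        have := congrFun (congrFun hR (i, a)) (j, b)
        simpa [choiMatrix, Matrix.mul_apply] using this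
      have hY : Y = ∑ i, ∑ j, Y i j • Matrix.single i j (1 : ℂ) := by
        conv_lhs => rw [Matrix.matrix_eq_sum_single Y]
        simp [Matrix.smul_single]
      conv_lhs => rw [hY]
      simp only [map_sum, map_smul, Matrix.sum_apply, Matrix.smul_apply, hC, smul_eq_mul,
        Finset.mul_sum]
      rw [Finset.sum_comm_cycle]
      refine Finset.sum_congr rfl fun k _ => ?_
      refine Finset.sum_congr rfl fun i _ => Finset.sum_congr rfl fun j _ => ?_
      ring
    let W (k : Fin N × Fin N) : Matrix (Fin m × Fin N) (Fin m × Fin N) ℂ :=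
      Matrix.of fun p q => if p.1 = q.1 then R k (p.2, q.2) else 0
    have key : (Matrix.of fun p q : Fin m × Fin N =>
        Φ (Matrix.of fun a b : Fin N => X (p.1, a) (q.1, b)) p.2 q.2)
        = ∑ k, (W k)ᴴ * X * W k := by
      ext p q
      rw [Matrix.of_apply, hΦ, Matrix.sum_apply]
      refine Finset.sum_congr rfl fun k _ => ?_
      simp only [Matrix.mul_apply, Matrix.of_apply, Matrix.conjTranspose_apply,
        Fintype.sum_prod_type, W, apply_ite star, star_zero, ite_mul, zero_mul, mul_ite, mul_zero,
        Finset.sum_mul]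
      simp [Finset.sum_ite_irrel]
      exact Finset.sum_comm
    rw [key]
    exact Matrix.posSemidef_sum _ fun k _ => hX.conjTranspose_mul_mul_same (W k)

/-- Three commuting traceless Hermitian involutions, the third being the product of the other
two. -/
structure IsKleinTriple {n : Type*} [Fintype n] [DecidableEq n] (K L J : Matrix n n ℂ) :
    Prop where
  isHermitian_left : K.IsHermitian
  isHermitian_mid : L.IsHermitian
  isHermitian_right : J.IsHermitian
  left_mul_left : K * K = 1
  mid_mul_mid : L * L = 1
  left_mul_mid : K * L = J
  mid_mul_left : L * K = J
  trace_left : K.trace = 0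
  trace_mid : L.trace = 0
  trace_right : J.trace = 0

namespace IsKleinTriple

variable {n : Type*} [Fintype n] [DecidableEq n] {K L J : Matrix n n ℂ}

theorem neg_right (h : IsKleinTriple K L J) : IsKleinTriple K (-L) (-J) where
  isHermitian_left := h.isHermitian_left
  isHermitian_mid := h.isHermitian_mid.neg
  isHermitian_right := h.isHermitian_right.neg
  left_mul_left := h.left_mul_left
  mid_mul_mid := by simp [h.mid_mul_mid]
  left_mul_mid := by simp [h.left_mul_mid]
  mid_mul_left := by simp [h.mid_mul_left]
  trace_left := h.trace_left
  trace_mid := by simp [h.trace_mid]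
  trace_right := by simp [h.trace_right]

theorem swap (h : IsKleinTriple K L J) : IsKleinTriple L K J where
  isHermitian_left := h.isHermitian_mid
  isHermitian_mid := h.isHermitian_left
  isHermitian_right := h.isHermitian_right
  left_mul_left := h.mid_mul_mid
  mid_mul_mid := h.left_mul_left
  left_mul_mid := h.mid_mul_left
  mid_mul_left := h.left_mul_mid
  trace_left := h.trace_mid
  trace_mid := h.trace_left
  trace_right := h.trace_right

theorem neg_left (h : IsKleinTriple K L J) : IsKleinTriple (-K) L (-J) :=
  h.swap.neg_right.swap

theorem mul_sum (h : IsKleinTriple K L J) (a b c : ℂ) :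
    (1 + a • K + b • L + c • J) * (1 + K + L + J) = (1 + a + b + c) • (1 + K + L + J) := by
  have h1 : K * J = L := by rw [← h.left_mul_mid, ← mul_assoc, h.left_mul_left, one_mul]
  have h2 : L * J = K := by rw [← h.mid_mul_left, ← mul_assoc, h.mid_mul_mid, one_mul]
  have h3 : J * K = L := by rw [← h.mid_mul_left, mul_assoc, h.left_mul_left, mul_one]
  have h4 : J * L = K := by rw [← h.left_mul_mid, mul_assoc, h.mid_mul_mid, mul_one]
  have h5 : J * J = 1 := by
    rw [← h.left_mul_mid, mul_assoc, h.left_mul_mid, h2, h.left_mul_left]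
  simp only [add_mul, mul_add, smul_mul_assoc, one_mul, mul_one, h.left_mul_left,
    h.mid_mul_mid, h.left_mul_mid, h.mid_mul_left, h1, h2, h3, h4, h5]
  module

theorem isHermitian_sum (h : IsKleinTriple K L J) : (1 + K + L + J).IsHermitian :=
  ((Matrix.isHermitian_one.add h.isHermitian_left).add h.isHermitian_mid).add h.isHermitian_right

theorem posSemidef_sum (h : IsKleinTriple K L J) : (1 + K + L + J).PosSemidef := by
  have h1 := Matrix.posSemidef_conjTranspose_mul_self (1 + K + L + J)
  have h2 := h.mul_sum 1 1 1
  simp only [one_smul] at h2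
  rw [h.isHermitian_sum.eq, h2] at h1
  have h3 := h1.smul (a := (1 / 4 : ℝ)) (by norm_num)
  convert h3 using 1
  module

theorem nonneg_of_posSemidef [Nonempty n] (h : IsKleinTriple K L J) {a b c : ℝ}
    (hC : (1 + (a : ℂ) • K + (b : ℂ) • L + (c : ℂ) • J).PosSemidef) : 0 ≤ 1 + a + b + c := by
  have h1 := (hC.conjTranspose_mul_mul_same (1 + K + L + J)).trace_nonneg
  have h2 := h.mul_sum 1 1 1
  simp only [one_smul] at h2
  rw [h.isHermitian_sum.eq, mul_assoc, h.mul_sum, mul_smul_comm, h2] at h1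
  simp only [Matrix.trace_smul, Matrix.trace_add, h.trace_left, h.trace_mid, h.trace_right,
    Matrix.trace_one, smul_eq_mul] at h1
  have h3 : (0 : ℝ) ≤ (1 + a + b + c) * (4 * Fintype.card n) := by
    rw [← Complex.zero_le_real]
    convert h1 using 1
    push_cast
    ring
  have h4 : (0 : ℝ) < 4 * Fintype.card n := by
    have : 0 < Fintype.card n := Fintype.card_pos
    positivity
  exact nonneg_of_mul_nonneg_left h3 h4

theorem posSemidef_iff [Nonempty n] (h : IsKleinTriple K L J) (a b c : ℝ) :
    (1 + (a : ℂ) • K + (b : ℂ) • L + (c : ℂ) • J).PosSemidef ↔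
      |a - b| ≤ 1 - c ∧ |a + b| ≤ 1 + c := by
  constructor
  · intro hC
    have h1 := h.nonneg_of_posSemidef hC
    have h2 := h.neg_right.nonneg_of_posSemidef (a := a) (b := -b) (c := -c) (by simpa using hC)
    have h3 := h.neg_left.nonneg_of_posSemidef (a := -a) (b := b) (c := -c) (by simpa using hC)
    have h4 := h.neg_left.neg_right.nonneg_of_posSemidef (a := -a) (b := -b) (c := c)
      (by simpa using hC)
    rw [abs_le, abs_le]
    refine ⟨⟨?_, ?_⟩, ?_, ?_⟩ <;> linarith
  · rw [abs_le, abs_le]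
    rintro ⟨⟨h1, h2⟩, h3, h4⟩
    have p1 := h.posSemidef_sum.smul (a := (1 + a + b + c) / 4) (by linarith)
    have p2 := h.neg_right.posSemidef_sum.smul (a := (1 + a - b - c) / 4) (by linarith)
    have p3 := h.neg_left.posSemidef_sum.smul (a := (1 - a + b - c) / 4) (by linarith)
    have p4 := h.neg_left.neg_right.posSemidef_sum.smul (a := (1 - a - b + c) / 4) (by linarith)
    convert ((p1.add p2).add p3).add p4 using 1
    simp only [Complex.coe_smul]
    module

end IsKleinTriple

/-- The traceless Hermitian matrix `∑ i, r i • σ_i` with Bloch vector `r`. -/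
noncomputable def pauliVec (r : Fin 3 → ℝ) : Matrix (Fin 2) (Fin 2) ℂ := ∑ i : Fin 3, r i • pauli i.succ

theorem pauliVec_eq (r : Fin 3 → ℝ) :
    pauliVec r = !![(r 2 : ℂ), r 0 - r 1 * Complex.I; r 0 + r 1 * Complex.I, -r 2] := by
  ext i j
  fin_cases i <;> fin_cases j <;> simp [pauliVec, pauli, Fin.sum_univ_three, sub_eq_add_neg]

theorem isHermitian_pauliVec (r : Fin 3 → ℝ) : (pauliVec r).IsHermitian := by
  rw [pauliVec_eq]
  ext i j
  fin_cases i <;> fin_cases j <;> simp [sub_eq_add_neg]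

theorem trace_pauliVec (r : Fin 3 → ℝ) : (pauliVec r).trace = 0 := by
  simp [pauliVec_eq, Matrix.trace_fin_two]

theorem pauliVec_neg (r : Fin 3 → ℝ) : pauliVec (-r) = -pauliVec r := by
  simp [pauliVec]

theorem pauliVec_mul (u v : Fin 3 → ℝ) :
    pauliVec u * pauliVec v =
      ((u ⬝ᵥ v : ℝ) : ℂ) • (1 : Matrix (Fin 2) (Fin 2) ℂ)
        + Complex.I • pauliVec (crossProduct u v) := by
  have hI := Complex.I_mul_I
  rw [pauliVec_eq, pauliVec_eq, pauliVec_eq, cross_apply]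
  ext i j
  fin_cases i <;> fin_cases j <;>
    simp [Matrix.mul_apply, Fin.sum_univ_two, dotProduct, Fin.sum_univ_three] <;>
    grind

theorem crossProduct_row_eq {A : Matrix (Fin 3) (Fin 3) ℝ} (hA : Aᵀ * A = 1)
    (hdet : A.det = 1) : crossProduct (A 0) (A 1) = A 2 := by
  have h : A.adjugate = Aᵀ := by
    calc A.adjugate = Aᵀ * A * A.adjugate := by rw [hA, one_mul]
      _ = Aᵀ := by rw [mul_assoc, Matrix.mul_adjugate, hdet, one_smul, mul_one]
  rw [Matrix.adjugate_fin_three] at h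
  have h0 := congrFun (congrFun h 0) 2
  have h1 := congrFun (congrFun h 1) 2
  have h2 := congrFun (congrFun h 2) 2
  simp at h0 h1 h2
  rw [cross_apply]
  ext i
  fin_cases i <;> simp <;> linarith

theorem row_dotProduct_row {A : Matrix (Fin 3) (Fin 3) ℝ} (hA : Aᵀ * A = 1) (i j : Fin 3) :
    A i ⬝ᵥ A j = if i = j then 1 else 0 := by
  have hA' : A * Aᵀ = 1 := mul_eq_one_comm.mp hA
  have h := congrFun (congrFun hA' i) j
  rw [Matrix.one_apply] at h
  rw [← h]
  rfl

theorem pauliVec_row_mul_self {A : Matrix (Fin 3) (Fin 3) ℝ} (hA : Aᵀ * A = 1) (i : Fin 3) :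
    pauliVec (A i) * pauliVec (A i) = 1 := by
  rw [pauliVec_mul, row_dotProduct_row hA, cross_self]
  simp [pauliVec]

theorem pauliVec_row_zero_mul_one {A : Matrix (Fin 3) (Fin 3) ℝ} (hA : Aᵀ * A = 1)
    (hdet : A.det = 1) :
    pauliVec (A 0) * pauliVec (A 1) = Complex.I • pauliVec (A 2) := by
  rw [pauliVec_mul, row_dotProduct_row hA, crossProduct_row_eq hA hdet]
  simp

theorem pauliVec_row_one_mul_zero {A : Matrix (Fin 3) (Fin 3) ℝ} (hA : Aᵀ * A = 1)
    (hdet : A.det = 1) :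
    pauliVec (A 1) * pauliVec (A 0) = -(Complex.I • pauliVec (A 2)) := by
  rw [pauliVec_mul, row_dotProduct_row hA, ← cross_anticomm, crossProduct_row_eq hA hdet,
    pauliVec_neg]
  simp

open scoped Kronecker in
theorem isKleinTriple_kronecker {A B : Matrix (Fin 3) (Fin 3) ℝ} (hA : Aᵀ * A = 1)
    (hAdet : A.det = 1) (hB : Bᵀ * B = 1) (hBdet : B.det = 1) :
    IsKleinTriple ((pauliVec (A 0))ᵀ ⊗ₖ pauliVec (B 0)) ((pauliVec (A 1))ᵀ ⊗ₖ pauliVec (B 1))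
      ((pauliVec (A 2))ᵀ ⊗ₖ pauliVec (B 2)) := by
  have hherm (u v : Fin 3 → ℝ) : ((pauliVec u)ᵀ ⊗ₖ pauliVec v).IsHermitian := by
    rw [Matrix.IsHermitian, Matrix.conjTranspose_kronecker, (isHermitian_pauliVec v).eq,
      (isHermitian_pauliVec u).transpose.eq]
  have htr (u v : Fin 3 → ℝ) : ((pauliVec u)ᵀ ⊗ₖ pauliVec v).trace = 0 := by
    rw [Matrix.trace_kronecker, trace_pauliVec, mul_zero]
  refine ⟨hherm _ _, hherm _ _, hherm _ _, ?_, ?_, ?_, ?_, htr _ _, htr _ _, htr _ _⟩ <;>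
    rw [← Matrix.mul_kronecker_mul, ← Matrix.transpose_mul]
  · simp [pauliVec_row_mul_self hA, pauliVec_row_mul_self hB]
  · simp [pauliVec_row_mul_self hA, pauliVec_row_mul_self hB]
  · rw [pauliVec_row_one_mul_zero hA hAdet, pauliVec_row_zero_mul_one hB hBdet, ← neg_smul,
      Matrix.transpose_smul, Matrix.smul_kronecker, Matrix.kronecker_smul, smul_smul]
    simp
  · rw [pauliVec_row_one_mul_zero hB hBdet, pauliVec_row_zero_mul_one hA hAdet, ← neg_smul,
      Matrix.transpose_smul, Matrix.smul_kronecker, Matrix.kronecker_smul, smul_smul]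
    simp

open scoped Kronecker in
theorem two_smul_choiMatrix {A B : Matrix (Fin 3) (Fin 3) ℝ} {d₁ d₂ d₃ : ℝ}
    {Φ : Matrix (Fin 2) (Fin 2) ℂ →ₗ[ℂ] Matrix (Fin 2) (Fin 2) ℂ}
    (hΦ0 : Φ (pauli 0) = pauli 0)
    (hΦ : ∀ r : Fin 3 → ℝ,
      Φ (pauliVec r) = pauliVec ((B * Matrix.diagonal ![d₁, d₂, d₃] * A).mulVec r)) :
    (2 : ℝ) • choiMatrix Φ =
      1 + (d₁ : ℂ) • ((pauliVec (A 0))ᵀ ⊗ₖ pauliVec (Bᵀ 0))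
        + (d₂ : ℂ) • ((pauliVec (A 1))ᵀ ⊗ₖ pauliVec (Bᵀ 1))
        + (d₃ : ℂ) • ((pauliVec (A 2))ᵀ ⊗ₖ pauliVec (Bᵀ 2)) := by
  have e00 : Matrix.single (0 : Fin 2) (0 : Fin 2) (1 : ℂ)
      = (1 / 2 : ℂ) • (pauli 0 + pauliVec ![0, 0, 1]) := by
    ext i j
    fin_cases i <;> fin_cases j <;> simp [pauliVec_eq, pauli, Matrix.single]
    norm_num
  have e11 : Matrix.single (1 : Fin 2) (1 : Fin 2) (1 : ℂ)
      = (1 / 2 : ℂ) • (pauli 0 - pauliVec ![0, 0, 1]) := by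
    ext i j
    fin_cases i <;> fin_cases j <;> simp [pauliVec_eq, pauli, Matrix.single]
    norm_num
  have e01 : Matrix.single (0 : Fin 2) (1 : Fin 2) (1 : ℂ)
      = (1 / 2 : ℂ) • (pauliVec ![1, 0, 0] + Complex.I • pauliVec ![0, 1, 0]) := by
    ext i j
    fin_cases i <;> fin_cases j <;> simp [pauliVec_eq, Matrix.single]
    norm_num
  have e10 : Matrix.single (1 : Fin 2) (0 : Fin 2) (1 : ℂ)
      = (1 / 2 : ℂ) • (pauliVec ![1, 0, 0] - Complex.I • pauliVec ![0, 1, 0]) := by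
    ext i j
    fin_cases i <;> fin_cases j <;> simp [pauliVec_eq, Matrix.single]
    norm_num
  have hI := Complex.I_mul_I
  ext ⟨i, a⟩ ⟨j, b⟩
  fin_cases i <;> fin_cases j <;>
    simp only [choiMatrix, Matrix.smul_apply, Matrix.of_apply, Fin.zero_eta, Fin.mk_one, e00, e01,
      e10, e11, map_smul, map_add, map_sub, hΦ0, hΦ] <;>
    fin_cases a <;> fin_cases b <;>
    simp [pauliVec_eq, pauli, Matrix.mulVec, dotProduct, Fin.sum_univ_three, Matrix.mul_apply,
      Matrix.diagonal] <;>
    grind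

theorem stmt_14 (A B : Matrix (Fin 3) (Fin 3) ℝ)
    (hA : Aᵀ * A = 1) (hAdet : A.det = 1) (hB : Bᵀ * B = 1) (hBdet : B.det = 1)
    (d₁ d₂ d₃ : ℝ) (M : Matrix (Fin 3) (Fin 3) ℝ)
    (hM : M = B * Matrix.diagonal ![d₁, d₂, d₃] * A)
    (ΦM : Matrix (Fin 2) (Fin 2) ℂ →ₗ[ℂ] Matrix (Fin 2) (Fin 2) ℂ)
    (hΦM0 : ΦM (pauli 0) = pauli 0)
    (hΦM : ∀ r : Fin 3 → ℝ,
      ΦM (∑ i : Fin 3, r i • pauli i.succ) = ∑ i : Fin 3, M.mulVec r i • pauli i.succ) :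
    CompletelyPositive ΦM ↔ (|d₁ - d₂| ≤ 1 - d₃ ∧ |d₁ + d₂| ≤ 1 + d₃) := by
  subst hM
  have hB' : Bᵀᵀ * Bᵀ = 1 := by rw [Matrix.transpose_transpose, mul_eq_one_comm.mp hB]
  have hBdet' : Bᵀ.det = 1 := by rw [Matrix.det_transpose, hBdet]
  rw [completelyPositive_iff_posSemidef_choiMatrix (by norm_num),
    ← (isKleinTriple_kronecker hA hAdet hB' hBdet').posSemidef_iff,
    ← two_smul_choiMatrix hΦM0 hΦM]
  constructor
  · intro h
    exact h.smul (by norm_num)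
  · intro h
    have h' := h.smul (a := (1 / 2 : ℝ)) (by norm_num)
    rwa [smul_smul, show (1 / 2 : ℝ) * 2 = 1 by norm_num, one_smul] at h'
end
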